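/- If two quantum channels (completely positive trace-preserving maps) S and E on M_d(ℂ) satisfy S ∘ E = id, then both S and E are unitary channels, i.e. there exists a unitary U with S(ρ) = U ρ U† and E(ρ) = U† ρ U for all ρ. -/

import Mathlib

open Matrix BigOperators

/-- A quantum channel on `M_d(ℂ)`: a completely positive trace-preserving map,
given by a finite Kraus family with `∑ Kᴴ K = 1`. -/
def IsChannel {d : ℕ} (Φ : Matrix (Fin d) (Fin d) ℂ → Matrix (Fin d) (Fin d) ℂ) : Prop :=
  ∃ (m : ℕ) (K : Fin m → Matrix (Fin d) (Fin d) ℂ),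
    (∑ k, (K k)ᴴ * K k = 1) ∧ ∀ ρ, Φ ρ = ∑ k, K k * ρ * (K k)ᴴ


lemma sum_normSq_zero {ι : Type*} [Fintype ι] (f : ι → ℂ)
    (h : ∑ k, f k * star (f k) = 0) (k : ι) : f k = 0 := by
  have h2 : ((∑ k, Complex.normSq (f k) : ℝ) : ℂ) = 0 := by
    rw [← h]; push_cast
    exact Finset.sum_congr rfl fun k _ => (Complex.mul_conj (f k)).symm
  have h3 : ∑ k, Complex.normSq (f k) = 0 := by exact_mod_cast h2
  rw [Finset.sum_eq_zero_iff_of_nonneg (fun i _ => Complex.normSq_nonneg _)] at h3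
  exact Complex.normSq_eq_zero.mp (h3 k (Finset.mem_univ k))

lemma kraus_id {d : ℕ} {ι : Type*} [Fintype ι] (M : ι → Matrix (Fin d) (Fin d) ℂ)
    (h : ∀ ρ, ∑ k, M k * ρ * (M k)ᴴ = ρ) (i0 : Fin d) (k : ι) :
    M k = (M k i0 i0) • (1 : Matrix (Fin d) (Fin d) ℂ) := by
  have H : ∀ a b i j, ∑ k, M k a i * star (M k b j) = if i = a ∧ j = b then 1 else 0 := by
    intro a b i j
    have := congrFun (congrFun (h (Matrix.single i j 1)) a) b
    rw [Matrix.sum_apply] at this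
    rw [Matrix.single_apply] at this
    rw [← this]
    refine Finset.sum_congr rfl fun k _ => ?_
    simp [Matrix.mul_apply, Matrix.single_apply, ite_and]
  ext a b
  by_cases hab : a = b
  · subst hab
    have := sum_normSq_zero (fun k => M k a a - M k i0 i0) (by
      simp only [star_sub, mul_sub, sub_mul, Finset.sum_sub_distrib, H]
      simp) k
    simpa using sub_eq_zero.mp this
  · have := sum_normSq_zero (fun k => M k a b) (by
      rw [H]; simp [Ne.symm hab]) k
    simpa [hab] using this

theorem channel_left_inverse_unitary {d : ℕ}
    (S E : Matrix (Fin d) (Fin d) ℂ → Matrix (Fin d) (Fin d) ℂ)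
    (hS : IsChannel S) (hE : IsChannel E)
    (hinv : ∀ ρ, S (E ρ) = ρ) :
    ∃ U : Matrix (Fin d) (Fin d) ℂ,
      Uᴴ * U = 1 ∧ U * Uᴴ = 1 ∧
      (∀ ρ, S ρ = U * ρ * Uᴴ) ∧ (∀ ρ, E ρ = Uᴴ * ρ * U) := by
  rcases Nat.eq_zero_or_pos d with rfl | hd
  · exact ⟨1, Subsingleton.elim _ _, Subsingleton.elim _ _,
      fun _ => Subsingleton.elim _ _, fun _ => Subsingleton.elim _ _⟩
  let i0 : Fin d := ⟨0, hd⟩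
  obtain ⟨m, A, hA, hSA⟩ := hS
  obtain ⟨n, B, hB, hEB⟩ := hE
  have hid : ∀ ρ, ∑ p : Fin m × Fin n, (A p.1 * B p.2) * ρ * (A p.1 * B p.2)ᴴ = ρ := by
    intro ρ
    conv_rhs => rw [← hinv ρ, hSA, hEB]
    rw [Fintype.sum_prod_type]
    simp only [Finset.mul_sum, Finset.sum_mul, conjTranspose_mul, Matrix.mul_assoc]
  have hc : ∀ k j, ∃ c : ℂ, A k * B j = c • (1 : Matrix (Fin d) (Fin d) ℂ) := fun k j =>
    ⟨_, kraus_id (fun p : Fin m × Fin n => A p.1 * B p.2) hid i0 (k, j)⟩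
  choose c hc using hc
  have hBB : ∀ j, (B j)ᴴ * B j
      = ((∑ k, Complex.normSq (c k j) : ℝ) : ℂ) • (1 : Matrix (Fin d) (Fin d) ℂ) := by
    intro j
    calc (B j)ᴴ * B j = (B j)ᴴ * (∑ k, (A k)ᴴ * A k) * B j := by rw [hA, Matrix.mul_one]
      _ = ∑ k, (A k * B j)ᴴ * (A k * B j) := by
        simp only [Finset.mul_sum, Finset.sum_mul, conjTranspose_mul, Matrix.mul_assoc]
      _ = _ := by
        push_cast
        rw [Finset.sum_smul]
        refine Finset.sum_congr rfl fun k _ => ?_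
        rw [hc, conjTranspose_smul, conjTranspose_one, smul_mul_smul_comm, Matrix.one_mul,
          Complex.normSq_eq_conj_mul_self]
        rfl
  obtain ⟨j, hj⟩ : ∃ j, ∑ k, Complex.normSq (c k j) ≠ 0 := by
    by_contra! hcon
    have h0 : ∑ k, (B k)ᴴ * B k = 0 := Finset.sum_eq_zero fun j _ => by
      rw [hBB, hcon]; simp
    rw [hB] at h0
    have := congrFun (congrFun h0 i0) i0
    simp at this
  have hBj := hBB j
  set l : ℝ := ∑ k, Complex.normSq (c k j) with hl
  have hl0 : 0 ≤ l := Finset.sum_nonneg fun _ _ => Complex.normSq_nonneg _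
  set s : ℂ := ((Real.sqrt l : ℝ) : ℂ) with hs
  have hss : s * s = (l : ℂ) := by rw [hs, ← Complex.ofReal_mul, Real.mul_self_sqrt hl0]
  have hlC : (l : ℂ) ≠ 0 := by exact_mod_cast hj
  have hs0 : s ≠ 0 := by rintro h; rw [h] at hss; simp at hss; exact hj (by exact_mod_cast hss.symm)
  have hstar : star s = s := by rw [hs]; exact Complex.conj_ofReal _
  let V : Matrix (Fin d) (Fin d) ℂ := s⁻¹ • B j
  have hBV : B j = s • V := by simp [V, smul_smul, hs0]
  have hV : Vᴴ * V = 1 := by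
    simp only [V]
    rw [conjTranspose_smul, smul_mul_smul_comm, hBj, smul_smul, star_inv₀, hstar, ← hss]
    have : s⁻¹ * s⁻¹ * (s * s) = 1 := by field_simp
    rw [this, one_smul]
  have hV' : V * Vᴴ = 1 := mul_eq_one_comm.mp hV
  clear_value V
  have hAk : ∀ k, A k = (s⁻¹ * c k j) • Vᴴ := by
    intro k
    have h1 := hc k j
    rw [hBV, Matrix.mul_smul] at h1
    calc A k = s⁻¹ • ((s • (A k * V)) * Vᴴ) := by
          rw [Matrix.smul_mul, smul_smul, inv_mul_cancel₀ hs0, one_smul, Matrix.mul_assoc, hV',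
            Matrix.mul_one]
      _ = _ := by rw [h1, Matrix.smul_mul, Matrix.one_mul, smul_smul]
  have hsum : ∑ k, (s⁻¹ * c k j) * star (s⁻¹ * c k j) = 1 := by
    have : ∀ k, (s⁻¹ * c k j) * star (s⁻¹ * c k j)
        = (s * s)⁻¹ * ((Complex.normSq (c k j) : ℝ) : ℂ) := by
      intro k
      rw [star_mul', star_inv₀, hstar, Complex.normSq_eq_conj_mul_self, mul_inv]
      change _ = s⁻¹ * s⁻¹ * (star (c k j) * c k j)
      ring
    rw [Finset.sum_congr rfl fun k _ => this k, ← Finset.mul_sum, hss, ← Complex.ofReal_sum, ← hl]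
    exact inv_mul_cancel₀ hlC
  have hSV : ∀ ρ, S ρ = Vᴴ * ρ * V := by
    intro ρ
    rw [hSA]
    have : ∀ k, A k * ρ * (A k)ᴴ = ((s⁻¹ * c k j) * star (s⁻¹ * c k j)) • (Vᴴ * ρ * V) := by
      intro k
      rw [hAk, conjTranspose_smul, conjTranspose_conjTranspose, Matrix.smul_mul, smul_mul_smul_comm]
    rw [Finset.sum_congr rfl fun k _ => this k, ← Finset.sum_smul, hsum, one_smul]
  refine ⟨Vᴴ, ?_, ?_, ?_, ?_⟩
  · rwa [conjTranspose_conjTranspose]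
  · rwa [conjTranspose_conjTranspose]
  · intro ρ; rw [conjTranspose_conjTranspose, hSV]
  · intro ρ
    rw [conjTranspose_conjTranspose]
    conv_rhs => rw [← hinv ρ, hSV]
    calc E ρ = (V * Vᴴ) * E ρ * (V * Vᴴ) := by rw [hV', Matrix.one_mul, Matrix.mul_one]
      _ = _ := by simp only [Matrix.mul_assoc]
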